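/- arXiv:2302.03119 — 2 statements merged into one kernel-verified Lean document; each statement's English description precedes it below -/
import Mathlib

section
/- Define J : n_{−1} → n_{−1} on the degree −1 stratum of n_{E_III} by J(X_{8+i}) = X_{16+i} and J(X_{16+i}) = −X_{8+i} for i = 1,…,8. Then the set of linear endomorphisms T of n_{−1} that commute with the restriction to n_{−1} of every strata-preserving derivation A of n_{E_III} and satisfy T² = −id is exactly {J, −J}. Thus the 2-step nilpotent Lie algebra n_{E_III} canonically determines a complex structure on n_{−1}, unique up to sign. -/
noncomputable section
open ComplexConjugate

/-- Points of `ℝ²⁴`, with coordinates `u^i = p (i-1)`, `x^i = p (7+i)`, `y^i = p (15+i)`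
for `i = 1, …, 8`. -/
abbrev Pt : Type := Fin 24 → ℝ
/-- The bracket of the 24-dimensional 2-step nilpotent Lie algebra `n_{E_III}`, in the
basis `X_1, …, X_24` (indexed here by `0, …, 23`): for each term `ε·λ^B∧λ^D` in the E_III
structure equations one has `[X_B, X_D] = -ε·X_A`, and `X_1, …, X_8` are central. -/
def br (v w : Pt) : Pt := fun k =>
  if h : (k : ℕ) < 8 then
    (![-((v 8 * w 23 - v 23 * w 8) + (v 9 * w 19 - v 19 * w 9)
        + (v 10 * w 22 - v 22 * w 10) + (v 11 * w 17 - v 17 * w 11)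
        + (v 12 * w 21 - v 21 * w 12) + (v 13 * w 20 - v 20 * w 13)
        + (v 14 * w 18 - v 18 * w 14) + (v 15 * w 16 - v 16 * w 15)),
       -((v 8 * w 19 - v 19 * w 8) + (v 23 * w 9 - v 9 * w 23)
        + (v 21 * w 10 - v 10 * w 21) + (v 11 * w 16 - v 16 * w 11)
        + (v 12 * w 22 - v 22 * w 12) + (v 18 * w 13 - v 13 * w 18)
        + (v 14 * w 20 - v 20 * w 14) + (v 17 * w 15 - v 15 * w 17)),
       -((v 8 * w 22 - v 22 * w 8) + (v 9 * w 21 - v 21 * w 9)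
        + (v 23 * w 10 - v 10 * w 23) + (v 20 * w 11 - v 11 * w 20)
        + (v 19 * w 12 - v 12 * w 19) + (v 13 * w 17 - v 17 * w 13)
        + (v 14 * w 16 - v 16 * w 14) + (v 18 * w 15 - v 15 * w 18)),
       -((v 9 * w 8 - v 8 * w 9) + (v 12 * w 10 - v 10 * w 12)
        + (v 15 * w 11 - v 11 * w 15) + (v 14 * w 13 - v 13 * w 14)
        + (v 17 * w 16 - v 16 * w 17) + (v 20 * w 18 - v 18 * w 20)
        + (v 23 * w 19 - v 19 * w 23) + (v 22 * w 21 - v 21 * w 22)),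
       -((v 8 * w 21 - v 21 * w 8) + (v 22 * w 9 - v 9 * w 22)
        + (v 10 * w 19 - v 19 * w 10) + (v 11 * w 18 - v 18 * w 11)
        + (v 23 * w 12 - v 12 * w 23) + (v 13 * w 16 - v 16 * w 13)
        + (v 17 * w 14 - v 14 * w 17) + (v 20 * w 15 - v 15 * w 20)),
       -((v 12 * w 8 - v 8 * w 12) + (v 10 * w 9 - v 9 * w 10)
        + (v 11 * w 14 - v 14 * w 11) + (v 15 * w 13 - v 13 * w 15)
        + (v 20 * w 16 - v 16 * w 20) + (v 18 * w 17 - v 17 * w 18)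
        + (v 19 * w 22 - v 22 * w 19) + (v 23 * w 21 - v 21 * w 23)),
       -((v 10 * w 8 - v 8 * w 10) + (v 9 * w 12 - v 12 * w 9)
        + (v 13 * w 11 - v 11 * w 13) + (v 15 * w 14 - v 14 * w 15)
        + (v 18 * w 16 - v 16 * w 18) + (v 17 * w 20 - v 20 * w 17)
        + (v 21 * w 19 - v 19 * w 21) + (v 23 * w 22 - v 22 * w 23)),
       -((v 8 * w 16 - v 16 * w 8) + (v 9 * w 17 - v 17 * w 9)
        + (v 10 * w 18 - v 18 * w 10) + (v 11 * w 19 - v 19 * w 11)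
        + (v 12 * w 20 - v 20 * w 12) + (v 13 * w 21 - v 21 * w 13)
        + (v 14 * w 22 - v 22 * w 14) + (v 15 * w 23 - v 23 * w 15))] : Fin 8 → ℝ) ⟨k, h⟩
  else 0
/-- The stratum `n_{-2} = span (X_1, …, X_8)`. -/
def Nm2 : Submodule ℝ Pt where
  carrier := {v | ∀ k : Fin 24, 8 ≤ (k : ℕ) → v k = 0}
  add_mem' := by
    intro a b ha hb
    simp only [Set.mem_setOf_eq] at ha hb ⊢
    intro k hk
    simp [Pi.add_apply, ha k hk, hb k hk]
  zero_mem' := by intro k _; rfl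
  smul_mem' := by
    intro c v hv
    simp only [Set.mem_setOf_eq] at hv ⊢
    intro k hk
    simp [Pi.smul_apply, hv k hk]

/-- The stratum `n_{-1} = span (X_9, …, X_24)`. -/
def Nm1 : Submodule ℝ Pt where
  carrier := {v | ∀ k : Fin 24, (k : ℕ) < 8 → v k = 0}
  add_mem' := by
    intro a b ha hb
    simp only [Set.mem_setOf_eq] at ha hb ⊢
    intro k hk
    simp [Pi.add_apply, ha k hk, hb k hk]
  zero_mem' := by intro k _; rfl
  smul_mem' := by
    intro c v hv
    simp only [Set.mem_setOf_eq] at hv ⊢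
    intro k hk
    simp [Pi.smul_apply, hv k hk]
/-- A strata-preserving derivation: a linear endomorphism `A` with `A (n_{-1}) ⊆ n_{-1}`,
`A (n_{-2}) ⊆ n_{-2}`, and `A [v, w] = [A v, w] + [v, A w]`. -/
def IsSPDer (A : Module.End ℝ Pt) : Prop :=
  (∀ v ∈ Nm1, A v ∈ Nm1) ∧ (∀ v ∈ Nm2, A v ∈ Nm2) ∧
    ∀ v w : Pt, A (br v w) = br (A v) w + br v (A w)
/-- The canonical complex structure on the stratum `n_{-1}`:
`J X_{8+i} = X_{16+i}` and `J X_{16+i} = -X_{8+i}` for `i = 1, …, 8`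
(extended by `0` on `n_{-2}`). -/
def Jfun (v : Pt) : Pt := fun k =>
  if (k : ℕ) < 8 then 0 else if (k : ℕ) < 16 then -v (k + 8) else v (k - 8)

/-- `Jfun` as a linear endomorphism of `ℝ²⁴`. -/
def Jlin : Pt →ₗ[ℝ] Pt where
  toFun := Jfun
  map_add' := by
    intro a b; funext k
    simp only [Jfun, Pi.add_apply]
    split_ifs <;> ring
  map_smul' := by
    intro c v; funext k
    simp only [Jfun, Pi.smul_apply, RingHom.id_apply, smul_eq_mul]
    split_ifs <;> ring

lemma Jlin_mem_Nm1 : ∀ v ∈ Nm1, Jlin v ∈ Nm1 := by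
  intro v _
  show ∀ k : Fin 24, (k : ℕ) < 8 → Jlin v k = 0
  intro k hk
  show Jfun v k = 0
  simp [Jfun, hk]

/-- `J` as a linear endomorphism of the stratum `n_{-1}`. -/
def JN1 : Module.End ℝ ↥Nm1 := Jlin.restrict Jlin_mem_Nm1

/-- The index of the coordinate entering the `k`-th coordinate of the derivation `boost a`. -/
def boostIdx (a : Fin 7) (k : Fin 24) : Fin 24 :=
  (![![7, 1, 2, 3, 4, 5, 6, 0, 15, 11, 14, 9,
      13, 12, 10, 8, 23, 19, 22, 17, 21, 20, 18, 16],
    ![0, 7, 2, 3, 4, 5, 6, 1, 11, 15, 13, 8,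
      14, 10, 12, 9, 19, 23, 21, 16, 22, 18, 20, 17],
    ![0, 1, 7, 3, 4, 5, 6, 2, 14, 13, 15, 12,
      11, 9, 8, 10, 22, 21, 23, 20, 19, 17, 16, 18],
    ![0, 1, 2, 7, 4, 5, 6, 3, 17, 16, 20, 23,
      18, 22, 21, 19, 9, 8, 12, 15, 10, 14, 13, 11],
    ![0, 1, 2, 3, 7, 5, 6, 4, 13, 14, 11, 10,
      15, 8, 9, 12, 21, 22, 19, 18, 23, 16, 17, 20],
    ![0, 1, 2, 3, 4, 7, 6, 5, 20, 18, 17, 22,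
      16, 23, 19, 21, 12, 10, 9, 14, 8, 15, 11, 13],
    ![0, 1, 2, 3, 4, 5, 7, 6, 18, 20, 16, 21,
      17, 19, 23, 22, 10, 12, 8, 13, 9, 11, 15, 14]] : Fin 7 → Fin 24 → Fin 24) a k

/-- The coefficient of the coordinate entering the `k`-th coordinate of `boost a`. -/
def boostCoeff (a : Fin 7) (k : Fin 24) : ℤ :=
  (![![2, 0, 0, 0, 0, 0, 0, 2, 1, 1, 1, 1,
      1, 1, 1, 1, 1, 1, 1, 1, 1, 1, 1, 1],
    ![0, 2, 0, 0, 0, 0, 0, 2, 1, -1, -1, 1,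
      1, -1, 1, -1, 1, -1, -1, 1, 1, -1, 1, -1],
    ![0, 0, 2, 0, 0, 0, 0, 2, 1, 1, -1, -1,
      -1, 1, 1, -1, 1, 1, -1, -1, -1, 1, 1, -1],
    ![0, 0, 0, 2, 0, 0, 0, 2, 1, -1, 1, 1,
      -1, 1, -1, -1, -1, 1, -1, -1, 1, -1, 1, 1],
    ![0, 0, 0, 0, 2, 0, 0, 2, 1, -1, 1, 1,
      -1, 1, -1, -1, 1, -1, 1, 1, -1, 1, -1, -1],
    ![0, 0, 0, 0, 0, 2, 0, 2, 1, 1, -1, -1,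
      -1, 1, 1, -1, -1, -1, 1, 1, 1, -1, -1, 1],
    ![0, 0, 0, 0, 0, 0, 2, 2, 1, -1, -1, 1,
      1, -1, 1, -1, -1, 1, 1, -1, -1, 1, -1, 1]] : Fin 7 → Fin 24 → ℤ) a k

/-- The derivations `boost a`, for `a = 0, …, 6`, which span a complement of `so(7)` in the
`so(7, 1)`-part of the derivation algebra. Their restrictions to `n_{-1}` are pairwise
anticommuting involutions. -/
def boost (a : Fin 7) : Module.End ℝ Pt where
  toFun v k := boostCoeff a k * v (boostIdx a k)
  map_add' v w := by ext k; simp [mul_add]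
  map_smul' c v := by ext k; simp [mul_left_comm]

lemma boost_apply (a : Fin 7) (v : Pt) (k : Fin 24) :
    boost a v k = boostCoeff a k * v (boostIdx a k) := rfl

lemma boost_single {a : Fin 7} {j k : Fin 24} {c : ℤ}
    (h : ∀ i, (boostCoeff a i * if boostIdx a i = j then 1 else 0) = if i = k then c else 0) :
    boost a (Pi.single j 1) = (c : ℝ) • Pi.single k 1 := by
  ext i
  have := congrArg (Int.cast : ℤ → ℝ) (h i)
  simpa [boost_apply, Pi.single_apply] using this

/-- The index of the coordinate entering the `k`-th coordinate of `J`. -/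
def jIdx (k : Fin 24) : Fin 24 := if (k : ℕ) < 16 then k + 8 else k - 8

/-- The coefficient of the coordinate entering the `k`-th coordinate of `J`. -/
def jCoeff (k : Fin 24) : ℤ := if (k : ℕ) < 8 then 0 else if (k : ℕ) < 16 then -1 else 1

lemma Jlin_apply (v : Pt) (k : Fin 24) : Jlin v k = jCoeff k * v (jIdx k) := by
  change Jfun v k = _
  unfold Jfun jCoeff jIdx
  split_ifs <;> simp

lemma br_apply_of_le (v w : Pt) {k : Fin 24} (hk : 8 ≤ (k : ℕ)) : br v w k = 0 := by
  simp [br, hk]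

lemma br_add_left (u v w : Pt) : br (u + v) w = br u w + br v w := by
  ext k
  fin_cases k <;> simp [br] <;> ring

lemma br_add_right (u v w : Pt) : br u (v + w) = br u v + br u w := by
  ext k
  fin_cases k <;> simp [br] <;> ring

lemma br_sub_left (u v w : Pt) : br (u - v) w = br u w - br v w := by
  rw [eq_sub_iff_add_eq, ← br_add_left, sub_add_cancel]

lemma br_sub_right (u v w : Pt) : br u (v - w) = br u v - br u w := by
  rw [eq_sub_iff_add_eq, ← br_add_right, sub_add_cancel]

lemma boost_mem_Nm1 (a : Fin 7) : ∀ v ∈ Nm1, boost a v ∈ Nm1 := by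
  intro v hv k hk
  have h : ∀ (a : Fin 7) (k : Fin 24), (k : ℕ) < 8 → (boostIdx a k : ℕ) < 8 := by decide
  rw [boost_apply, hv _ (h a k hk), mul_zero]

lemma boost_mem_Nm2 (a : Fin 7) : ∀ v ∈ Nm2, boost a v ∈ Nm2 := by
  intro v hv k hk
  have h : ∀ (a : Fin 7) (k : Fin 24), 8 ≤ (k : ℕ) → 8 ≤ (boostIdx a k : ℕ) := by decide
  rw [boost_apply, hv _ (h a k hk), mul_zero]

set_option maxHeartbeats 1000000 in
lemma br_boost_seven (a : Fin 7) (v w : Pt) :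
    br (boost a v) w 7 = br v w (a.castLE (by decide)) := by
  fin_cases a <;> simp [br, boost_apply, boostIdx, boostCoeff] <;> ring

lemma boost_apply_seven (a : Fin 7) (v : Pt) :
    boost a v 7 = 2 * v (a.castLE (by decide)) := by
  have h : ∀ a : Fin 7, boostCoeff a 7 = 2 ∧ boostIdx a 7 = a.castLE (by decide) := by decide
  simp [boost_apply, h a]

lemma boost_apply_castLE (a b : Fin 7) (v : Pt) :
    boost a v (b.castLE (by decide)) = if a = b then 2 * v 7 else 0 := by
  have h : ∀ a b : Fin 7, boostCoeff a (b.castLE (by decide)) = (if a = b then 2 else 0) ∧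
      (a = b → boostIdx a (b.castLE (by decide)) = 7) := by
    decide
  rw [boost_apply, (h a b).1]
  split_ifs with hab
  · simp [(h a b).2 hab]
  · simp

/-- The Clifford relations satisfied by the boosts on `n_{-1}`. -/
lemma boost_boost_add_mem_Nm2 (a b : Fin 7) (v : Pt) :
    boost a (boost b v) + boost b (boost a v) - (if a = b then (2 : ℝ) else 0) • v ∈ Nm2 := by
  intro k hk
  have h : ∀ (a b : Fin 7) (k : Fin 24), 8 ≤ (k : ℕ) →
      boostIdx b (boostIdx a k) = boostIdx a (boostIdx b k) ∧
      (a = b → boostIdx a (boostIdx b k) = k) ∧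
      boostCoeff a k * boostCoeff b (boostIdx a k) +
        boostCoeff b k * boostCoeff a (boostIdx b k) = if a = b then 2 else 0 := by
    decide
  obtain ⟨h1, h2, h3⟩ := h a b k hk
  have h3 := congrArg (Int.cast : ℤ → ℝ) h3
  push_cast at h3
  simp only [Pi.sub_apply, Pi.add_apply, Pi.smul_apply, smul_eq_mul, boost_apply, h1]
  rw [← mul_assoc, ← mul_assoc, ← add_mul, h3]
  split_ifs with hab
  · rw [h2 hab, sub_self]
  · simp

lemma br_swap (v w : Pt) : br v w = -br w v := by
  ext k
  fin_cases k <;> simp [br] <;> ring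

lemma br_eq_zero_of_mem_Nm2 {v : Pt} (hv : v ∈ Nm2) (w : Pt) : br v w = 0 := by
  have h : ∀ k : Fin 24, 8 ≤ (k : ℕ) → v k = 0 := hv
  ext k
  fin_cases k <;> simp [br, h]

lemma boost_isSPDer (a : Fin 7) : IsSPDer (boost a) := by
  refine ⟨boost_mem_Nm1 a, boost_mem_Nm2 a, fun v w => ?_⟩
  have swap (v w : Pt) (k : Fin 24) : br v w k = -br w v k := congrFun (br_swap v w) k
  ext k
  rw [Pi.add_apply]
  rcases le_or_gt 8 (k : ℕ) with hk | hk
  · rw [br_apply_of_le _ _ hk, br_apply_of_le _ _ hk, add_zero]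
    exact boost_mem_Nm2 a _ (fun j hj => br_apply_of_le v w hj) k hk
  rcases Nat.lt_succ_iff_lt_or_eq.1 hk with hk | hk
  · obtain ⟨b, rfl⟩ : ∃ b : Fin 7, k = b.castLE (by decide) := ⟨⟨k, hk⟩, rfl⟩
    have hz := congrFun (br_eq_zero_of_mem_Nm2 (boost_boost_add_mem_Nm2 a b v) w) 7
    have e1 := br_boost_seven b (boost a v) w
    have e2 := br_boost_seven b v (boost a w)
    have e3 := br_boost_seven a w (boost b v)
    have e4 := br_boost_seven a (boost b v) w
    have e5 := swap (boost b v) (boost a w) 7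
    have e6 := swap (boost b v) w (a.castLE (by decide))
    rw [br_sub_left, br_add_left, Pi.sub_apply, Pi.add_apply, Pi.zero_apply] at hz
    rw [boost_apply_castLE]
    split_ifs with hab
    · rw [if_pos hab, two_smul, br_add_left, Pi.add_apply] at hz
      linarith
    · rw [if_neg hab, zero_smul, br_eq_zero_of_mem_Nm2 Nm2.zero_mem, Pi.zero_apply] at hz
      linarith
  · obtain rfl : k = 7 := Fin.ext hk
    rw [boost_apply_seven, swap v (boost a w), br_boost_seven, br_boost_seven,
      swap w v (a.castLE (by decide))]
    ring

lemma br_Jlin_add (v w : Pt) : br (Jlin v) w + br v (Jlin w) = 0 := by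
  ext k
  fin_cases k <;> simp [br, Jlin, Jfun] <;> ring

lemma Jlin_boost (a : Fin 7) (v : Pt) : Jlin (boost a v) = boost a (Jlin v) := by
  have h : ∀ (a : Fin 7) (k : Fin 24), jCoeff k * boostCoeff a (jIdx k) =
      boostCoeff a k * jCoeff (boostIdx a k) ∧
      (jCoeff k = 0 ∨ boostIdx a (jIdx k) = jIdx (boostIdx a k)) := by
    decide
  ext k
  obtain ⟨h1, h2⟩ := h a k
  have h1' := congrArg (Int.cast : ℤ → ℝ) h1
  push_cast at h1'
  rw [Jlin_apply, boost_apply, boost_apply, Jlin_apply, ← mul_assoc, ← mul_assoc, ← h1']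
  rcases h2 with h2 | h2 <;> simp [h2]

lemma Jlin_Jlin {v : Pt} (hv : v ∈ Nm1) : Jlin (Jlin v) = -v := by
  have h : ∀ j : Fin 24, (j : ℕ) < 8 → v j = 0 := hv
  ext k
  fin_cases k <;> simp [Jlin, Jfun, h]

/-- The pairing of degree `-1` vectors by the last component of the bracket is nondegenerate. -/
lemma eq_zero_of_br_seven {v : Pt} (hv : v ∈ Nm1) (h : ∀ w ∈ Nm1, br v w 7 = 0) : v = 0 := by
  have h0 := h _ (Jlin_mem_Nm1 v hv)
  have hv' : ∀ j : Fin 24, (j : ℕ) < 8 → v j = 0 := hv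
  have hs : ∑ k, v k ^ 2 = 0 := by
    simp [br, Jlin, Jfun] at h0
    simp [Fin.sum_univ_succ, hv']
    linarith
  ext k
  have := (Finset.sum_eq_zero_iff_of_nonneg fun i _ => sq_nonneg (v i)).1 hs k (Finset.mem_univ k)
  simpa using this

lemma single_mem_Nm1 {k : Fin 24} (hk : 8 ≤ (k : ℕ)) : (Pi.single k 1 : Pt) ∈ Nm1 := by
  intro j hj
  have : j ≠ k := by rintro rfl; omega
  simp [this]

/-- A linear map on `n_{-1}` which commutes with all boosts and kills `X_9` is zero. -/
lemma eq_zero_of_commute_boost {Y : Module.End ℝ Pt}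
    (hY : ∀ a, ∀ v ∈ Nm1, Y (boost a v) = boost a (Y v))
    (h8 : Y (Pi.single 8 1) = 0) {v : Pt} (hv : v ∈ Nm1) : Y v = 0 := by
  have step (a : Fin 7) (j k : Fin 24) (c : ℤ) (h0 : Y (Pi.single j 1) = 0) (hj : 8 ≤ (j : ℕ))
      (hc : c ≠ 0)
      (h : ∀ i, (boostCoeff a i * if boostIdx a i = j then 1 else 0) = if i = k then c else 0) :
      Y (Pi.single k 1) = 0 := by
    have hcomm := hY a _ (single_mem_Nm1 hj)
    rw [h0, map_zero, boost_single h, map_smul] at hcomm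
    exact (smul_eq_zero.1 hcomm).resolve_left (Int.cast_ne_zero.2 hc)
  have h15 := step 0 8 15 1 h8 (by decide) (by decide) (by decide)
  have h11 := step 1 8 11 1 h8 (by decide) (by decide) (by decide)
  have h14 := step 2 8 14 1 h8 (by decide) (by decide) (by decide)
  have h17 := step 3 8 17 1 h8 (by decide) (by decide) (by decide)
  have h13 := step 4 8 13 1 h8 (by decide) (by decide) (by decide)
  have h20 := step 5 8 20 1 h8 (by decide) (by decide) (by decide)
  have h18 := step 6 8 18 1 h8 (by decide) (by decide) (by decide)
  have h9 := step 1 15 9 (-1) h15 (by decide) (by decide) (by decide)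
  have h10 := step 2 15 10 (-1) h15 (by decide) (by decide) (by decide)
  have h19 := step 3 15 19 (-1) h15 (by decide) (by decide) (by decide)
  have h12 := step 4 15 12 (-1) h15 (by decide) (by decide) (by decide)
  have h21 := step 5 15 21 (-1) h15 (by decide) (by decide) (by decide)
  have h22 := step 6 15 22 (-1) h15 (by decide) (by decide) (by decide)
  have h23 := step 3 11 23 1 h11 (by decide) (by decide) (by decide)
  have h16 := step 3 9 16 (-1) h9 (by decide) (by decide) (by decide)
  have hv' : ∀ j : Fin 24, (j : ℕ) < 8 → v j = 0 := hv
  rw [pi_eq_sum_univ' v, map_sum]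
  refine Finset.sum_eq_zero fun k _ => ?_
  rw [map_smul]
  by_cases hk8 : (k : ℕ) < 8
  · rw [hv' k hk8, zero_smul]
  · fin_cases k <;> first | (simp at hk8; done) | simp_all

/-- The index of the coordinate entering the `k`-th coordinate of a product of four boosts. -/
def wordIdx (a b c d : Fin 7) (k : Fin 24) : Fin 24 :=
  boostIdx d (boostIdx c (boostIdx b (boostIdx a k)))

/-- The coefficient of the coordinate entering the `k`-th coordinate of a product of four
boosts. -/
def wordCoeff (a b c d : Fin 7) (k : Fin 24) : ℤ :=
  boostCoeff a k * boostCoeff b (boostIdx a k) * boostCoeff c (boostIdx b (boostIdx a k)) *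
    boostCoeff d (boostIdx c (boostIdx b (boostIdx a k)))

lemma word_apply (a b c d : Fin 7) (v : Pt) (k : Fin 24) :
    boost a (boost b (boost c (boost d v))) k = wordCoeff a b c d k * v (wordIdx a b c d k) := by
  simp only [boost_apply, wordCoeff, wordIdx]
  push_cast
  ring

/-- The commutant of the boosts on `n_{-1}` is spanned by the identity and `J`. -/
lemma exists_of_commute_boost {X : Module.End ℝ Pt} (hX : ∀ v ∈ Nm1, X v ∈ Nm1)
    (hc : ∀ a, ∀ v ∈ Nm1, X (boost a v) = boost a (X v)) :
    ∃ x y : ℝ, ∀ v ∈ Nm1, X v = x • v + y • Jlin v := by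
  have he := single_mem_Nm1 (k := 8) (by decide)
  set e : Pt := Pi.single 8 1 with he_def
  have hword (a b c d : Fin 7)
      (h : ∀ i, (wordCoeff a b c d i * if wordIdx a b c d i = 8 then 1 else 0) =
        if i = 8 then -1 else 0) (k : Fin 24)
      (hk : wordIdx a b c d k = k ∧ wordCoeff a b c d k = 1) : X e k = 0 := by
    have hwe : boost a (boost b (boost c (boost d e))) = -e := by
      ext i
      have := congrArg (Int.cast : ℤ → ℝ) (h i)
      rw [word_apply, he_def, Pi.neg_apply, Pi.single_apply, Pi.single_apply]
      split_ifs at this ⊢ <;> simp_all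
    have hd := boost_mem_Nm1 d _ he
    have hcd := boost_mem_Nm1 c _ hd
    have hbcd := boost_mem_Nm1 b _ hcd
    have hXk : boost a (boost b (boost c (boost d (X e)))) k = (-X e) k := by
      rw [← hc d _ he, ← hc c _ hd, ← hc b _ hcd, ← hc a _ hbcd, hwe, map_neg]
    rw [word_apply, hk.1, hk.2, Int.cast_one, one_mul, Pi.neg_apply] at hXk
    linarith
  have hcover : ∀ k : Fin 24, (k : ℕ) < 8 ∨ k = 8 ∨ k = 16 ∨
      (wordIdx 0 1 2 4 k = k ∧ wordCoeff 0 1 2 4 k = 1) ∨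
      (wordIdx 0 1 5 6 k = k ∧ wordCoeff 0 1 5 6 k = 1) ∨
      (wordIdx 0 2 3 5 k = k ∧ wordCoeff 0 2 3 5 k = 1) := by
    decide
  have hXe : X e = X e 8 • e + X e 16 • Jlin e := by
    have hJe : Jlin e = Pi.single 16 1 := by
      ext k
      fin_cases k <;> simp [Jlin, Jfun, he_def]
    have hzero : ∀ k, k ≠ 8 → k ≠ 16 → X e k = 0 := by
      intro k h8 h16
      rcases hcover k with h | h | h | h | h | h
      · exact hX e he k h
      · exact absurd h h8
      · exact absurd h h16
      · exact hword 0 1 2 4 (by decide) k h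
      · exact hword 0 1 5 6 (by decide) k h
      · exact hword 0 2 3 5 (by decide) k h
    rw [hJe]
    ext k
    by_cases h8 : k = 8
    · simp [h8, he_def]
    by_cases h16 : k = 16
    · simp [h16, he_def]
    · rw [hzero k h8 h16]
      simp [h8, h16, he_def]
  refine ⟨X e 8, X e 16, fun v hv => ?_⟩
  have h0 := eq_zero_of_commute_boost (Y := X - X e 8 • 1 - X e 16 • Jlin) (v := v)
    (fun a w hw => by simp [hc a w hw, Jlin_boost a w])
    (by
      simp only [LinearMap.sub_apply, LinearMap.smul_apply, Module.End.one_apply]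
      rw [← he_def, sub_sub, sub_eq_zero]
      exact hXe) hv
  simp only [LinearMap.sub_apply, LinearMap.smul_apply, Module.End.one_apply] at h0
  rw [sub_sub, sub_eq_zero] at h0
  exact h0

/-- An infinitesimal isometry of all components of the bracket commutes with the boosts. -/
lemma commute_boost_of_br_add_eq_zero {B : Module.End ℝ Pt} (hB : ∀ v ∈ Nm1, B v ∈ Nm1)
    (h : ∀ v ∈ Nm1, ∀ w ∈ Nm1, br (B v) w + br v (B w) = 0) (a : Fin 7) {v : Pt}
    (hv : v ∈ Nm1) : B (boost a v) = boost a (B v) := by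
  have hbv := boost_mem_Nm1 a v hv
  rw [← sub_eq_zero]
  refine eq_zero_of_br_seven (Nm1.sub_mem (hB _ hbv) (boost_mem_Nm1 a _ (hB v hv))) fun w hw => ?_
  have h1 := congrFun (h _ hbv w hw) 7
  have h2 := congrFun (h v hv w hw) (a.castLE (by decide))
  simp only [Pi.add_apply, br_boost_seven, Pi.zero_apply] at h1 h2
  rw [br_sub_left, Pi.sub_apply, br_boost_seven]
  linarith

/-- Strata-preserving derivations are complex linear on `n_{-1}`. -/
lemma IsSPDer.comm_Jlin {A : Module.End ℝ Pt} (hA : IsSPDer A) {v : Pt} (hv : v ∈ Nm1) :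
    Jlin (A v) = A (Jlin v) := by
  obtain ⟨h1, -, hder⟩ := hA
  have hJ := Jlin_mem_Nm1
  set B : Module.End ℝ Pt := A * Jlin - Jlin * A with hBdef
  have hBapp (w : Pt) : B w = A (Jlin w) - Jlin (A w) := rfl
  have hB : ∀ w ∈ Nm1, B w ∈ Nm1 := fun w hw =>
    Nm1.sub_mem (h1 _ (hJ _ hw)) (hJ _ (h1 _ hw))
  obtain ⟨x, y, hxy⟩ := exists_of_commute_boost hB fun a w hw =>
    commute_boost_of_br_add_eq_zero hB (fun v _ w _ => by
      have e1 := hder (Jlin v) w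
      have e2 := hder v (Jlin w)
      have e3 := br_Jlin_add v (A w)
      have e4 := br_Jlin_add (A v) w
      have e5 := congrArg A (br_Jlin_add v w)
      rw [map_add, map_zero, e1, e2] at e5
      rw [hBapp, hBapp, br_sub_left, br_sub_right]
      linear_combination (exp := 1) e5 - e3 - e4) a hw
  have hanti : B (Jlin v) + Jlin (B v) = 0 := by
    rw [hBapp, hBapp, Jlin_Jlin hv, map_sub, Jlin_Jlin (h1 v hv), map_neg]
    abel
  have hcomm : B (Jlin v) = Jlin (B v) := by
    rw [hxy v hv, hxy _ (hJ v hv), map_add, map_smul, map_smul]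
  have hzero : Jlin (B v) = 0 := by
    rw [hcomm, ← two_smul ℝ] at hanti
    simpa using hanti
  have hBv : B v = 0 := by
    rw [← neg_eq_zero, ← Jlin_Jlin (hB v hv), hzero, map_zero]
  exact (sub_eq_zero.1 hBv).symm

lemma JN1_mul_JN1 : JN1 * JN1 = -1 := by
  ext1 v
  exact Subtype.ext (Jlin_Jlin v.2)

lemma commute_JN1 {A : Module.End ℝ Pt} (hA : IsSPDer A) : Commute JN1 (A.restrict hA.1) := by
  ext1 v
  exact Subtype.ext (hA.comm_Jlin v.2)

/-- The projection of `n_{E_III}` onto `n_{-1}` along `n_{-2}`. -/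
def projNm1 : Pt →ₗ[ℝ] ↥Nm1 where
  toFun v := ⟨fun k => if (k : ℕ) < 8 then 0 else v k, fun k hk => if_pos hk⟩
  map_add' v w := by
    ext k
    by_cases hk : (k : ℕ) < 8 <;> simp [hk]
  map_smul' c v := by
    ext k
    by_cases hk : (k : ℕ) < 8 <;> simp [hk]

lemma projNm1_coe (v : ↥Nm1) : projNm1 v = v := by
  ext k
  by_cases hk : (k : ℕ) < 8
  · simpa [projNm1, hk] using (v.2 k hk).symm
  · simp [projNm1, hk]

/-- An endomorphism of `n_{-1}` commuting with the strata-preserving derivations is complex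
scalar. -/
lemma exists_eq_smul_add_smul_JN1 {T : Module.End ℝ ↥Nm1}
    (hT : ∀ (A : Module.End ℝ Pt) (hA : IsSPDer A), Commute T (A.restrict hA.1)) :
    ∃ x y : ℝ, T = x • 1 + y • JN1 := by
  obtain ⟨x, y, h⟩ := exists_of_commute_boost (X := Nm1.subtype ∘ₗ T ∘ₗ projNm1)
    (fun v _ => (T (projNm1 v)).2) (fun a v hv => by
      have hc := LinearMap.congr_fun (hT _ (boost_isSPDer a)).eq ⟨v, hv⟩
      have e1 := projNm1_coe ⟨v, hv⟩
      have e2 := projNm1_coe ⟨boost a v, boost_mem_Nm1 a v hv⟩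
      simp only at e1 e2
      simp only [LinearMap.comp_apply, e1, e2]
      exact congrArg Subtype.val hc)
  refine ⟨x, y, LinearMap.ext fun v => Subtype.ext ?_⟩
  have hv := h v v.2
  simp only [LinearMap.comp_apply, projNm1_coe] at hv
  exact hv

/-- The set of linear endomorphisms `T` of `n_{-1}` that commute with the restriction to
`n_{-1}` of every strata-preserving derivation of `n_{E_III}` and satisfy `T² = -id` is
exactly `{J, -J}`: the nilpotent Lie algebra `n_{E_III}` canonically determines a complex
structure on `n_{-1}`, unique up to sign. -/
theorem nEIII_canonical_complex_structure :
    {T : Module.End ℝ ↥Nm1 | (∀ (A : Module.End ℝ Pt) (hA : IsSPDer A),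
        Commute T (A.restrict hA.1)) ∧ T * T = -1} =
      {JN1, -JN1} := by
  ext T
  simp only [Set.mem_ofPred_eq, Set.mem_insert_iff, Set.mem_singleton_iff]
  constructor
  · rintro ⟨hT, hsq⟩
    obtain ⟨x, y, rfl⟩ := exists_eq_smul_add_smul_JN1 hT
    have happ := LinearMap.congr_fun hsq ⟨Pi.single 8 1, single_mem_Nm1 (by decide)⟩
    have h8 : x * x - y * y = -1 := by
      simpa [JN1, Jlin, Jfun, sub_eq_add_neg,
        show (16 : Fin 24) + -8 = 8 from rfl] using congrFun (congrArg Subtype.val happ) 8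
    have h16 : x * y + y * x = 0 := by
      simpa [JN1, Jlin, Jfun] using congrFun (congrArg Subtype.val happ) 16
    have h16 : x = 0 ∨ y = 0 := by
      rw [← mul_eq_zero]
      linarith
    rcases h16 with rfl | rfl
    · have hy : (y - 1) * (y + 1) = 0 := by linarith
      rcases mul_eq_zero.1 hy with h | h
      · left
        rw [sub_eq_zero.1 h, zero_smul, zero_add, one_smul]
      · right
        rw [eq_neg_of_add_eq_zero_left h, zero_smul, zero_add]
        ext1 v
        simp
    · nlinarith [mul_self_nonneg x]
  · rintro (rfl | rfl)
    · exact ⟨fun A hA => commute_JN1 hA, JN1_mul_JN1⟩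
    · refine ⟨fun A hA => ?_, ?_⟩
      · ext1 v
        have h := LinearMap.congr_fun (commute_JN1 hA).eq v
        simp only [Module.End.mul_apply] at h
        simp [h]
      · ext1 v
        have h := LinearMap.congr_fun JN1_mul_JN1 v
        simp only [Module.End.mul_apply] at h
        simp [h]
end
end

section
/- On the degree −1 stratum n_{−1} of the nilpotent Lie algebra n_{E_III}, the canonical complex structure J defined by J(X_{8+i}) = X_{16+i}, J(X_{16+i}) = −X_{8+i} (i = 1,…,8) is compatible with the bracket in the Levi–Tanaka (partial integrability) sense: [Jv, Jw] = [v, w] for all v, w ∈ n_{−1}; consequently also [Jv, w] + [v, Jw] = 0 for all v, w ∈ n_{−1}. -/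
noncomputable section
open ComplexConjugate

/-- The stratum `n_{-1} = span (X_9, …, X_24)`, as a set. -/
def Nm1set : Set Pt := {v | ∀ k : Fin 24, (k : ℕ) < 8 → v k = 0}

/-- `J` preserves the bracket of any two vectors, since the bracket only sees the components
in `n_{-1}`. -/
theorem br_Jfun_Jfun (v w : Pt) : br (Jfun v) (Jfun w) = br v w := by
  funext k
  by_cases h : (k : ℕ) < 8
  · obtain ⟨i, rfl⟩ : ∃ i : Fin 8, k = Fin.castLE (by norm_num) i := ⟨⟨k, h⟩, rfl⟩
    fin_cases i <;> simp [br, Jfun] <;> ring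
  · simp [br, h]

theorem Jfun_Jfun {v : Pt} (hv : v ∈ Nm1set) : Jfun (Jfun v) = -v := by
  funext k
  have hk := hv k
  fin_cases k <;> simp_all [Jfun]

theorem br_neg_left (v w : Pt) : br (-v) w = -br v w := by
  funext k
  by_cases h : (k : ℕ) < 8
  · obtain ⟨i, rfl⟩ : ∃ i : Fin 8, k = Fin.castLE (by norm_num) i := ⟨⟨k, h⟩, rfl⟩
    fin_cases i <;> simp [br] <;> ring
  · simp [br, h]

/-- On the stratum `n_{-1}` of `n_{E_III}`, the canonical complex structure `J` is
compatible with the bracket in the Levi–Tanaka (partial integrability) sense: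
`[J v, J w] = [v, w]`, and consequently `[J v, w] + [v, J w] = 0`. -/
theorem nEIII_J_partial_integrability :
    ∀ v ∈ Nm1set, ∀ w ∈ Nm1set,
      br (Jfun v) (Jfun w) = br v w ∧ br (Jfun v) w + br v (Jfun w) = 0 := by
  intro v hv w _
  refine ⟨br_Jfun_Jfun v w, ?_⟩
  rw [← br_Jfun_Jfun (Jfun v) w, Jfun_Jfun hv, br_neg_left, neg_add_cancel]
end
end
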